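/- arXiv:2212.12267 — 2 statements merged into one kernel-verified Lean document; each statement's English description precedes it below -/
import Mathlib

section
/- The map g ↦ ⟦h,g⟧ is skew-adjoint with respect to the L² pairing: for all smooth compactly supported functions f, g, h on phase space ℝ^N × ℝ^N, the integral over ℝ^{2N} of f·⟦h,g⟧ equals minus the integral over ℝ^{2N} of ⟦h,f⟧·g. -/
/-- Partial derivative in the position variable `q i` on phase space `ℝ^N × ℝ^N`. -/
noncomputable def dq (N : ℕ) (i : Fin N) (f : (Fin N → ℝ) × (Fin N → ℝ) → ℝ) :
    (Fin N → ℝ) × (Fin N → ℝ) → ℝ :=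
  fun x => fderiv ℝ f x (Pi.single i 1, 0)

/-- Partial derivative in the momentum variable `p i` on phase space `ℝ^N × ℝ^N`. -/
noncomputable def dp (N : ℕ) (i : Fin N) (f : (Fin N → ℝ) × (Fin N → ℝ) → ℝ) :
    (Fin N → ℝ) × (Fin N → ℝ) → ℝ :=
  fun x => fderiv ℝ f x (0, Pi.single i 1)

/-- Iterated bidifferential operator: `Dpow N k f g = f D_ω^k g`, with
`f D_ω^0 g = f·g` and
`f D_ω^{k+1} g = ∑ i ((∂f/∂q_i) D_ω^k (∂g/∂p_i) − (∂f/∂p_i) D_ω^k (∂g/∂q_i))`. -/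
noncomputable def Dpow (N : ℕ) : ℕ → ((Fin N → ℝ) × (Fin N → ℝ) → ℝ) →
    ((Fin N → ℝ) × (Fin N → ℝ) → ℝ) → (Fin N → ℝ) × (Fin N → ℝ) → ℝ
  | 0, f, g => fun x => f x * g x
  | k + 1, f, g => fun x =>
      ∑ i : Fin N, (Dpow N k (dq N i f) (dp N i g) x - Dpow N k (dp N i f) (dq N i g) x)

/-- The generalized Moyal bracket `⟦f,g⟧ = ∑_{n=0}^{N₀} a_n ħ^{2n} (f D_ω^{2n+1} g)`,
where `hbar` plays the role of `ħ`. -/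
noncomputable def gmb (N : ℕ) (a : ℕ → ℝ) (hbar : ℝ) (N₀ : ℕ)
    (f g : (Fin N → ℝ) × (Fin N → ℝ) → ℝ) : (Fin N → ℝ) × (Fin N → ℝ) → ℝ :=
  fun x => ∑ n ∈ Finset.range (N₀ + 1), a n * hbar ^ (2 * n) * Dpow N (2 * n + 1) f g x

open MeasureTheory

open scoped ContDiff

section DirectionalDerivative

variable {E : Type*} [NormedAddCommGroup E] [NormedSpace ℝ E]

theorem contDiff_fderiv_apply_const {f : E → ℝ} (hf : ContDiff ℝ ∞ f) (v : E) :
    ContDiff ℝ ∞ fun x => fderiv ℝ f x v :=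
  (hf.fderiv_right le_rfl).clm_apply contDiff_const

theorem fderiv_fderiv_apply_comm {f : E → ℝ} (hf : ContDiff ℝ ∞ f) (v w : E) :
    (fun x => fderiv ℝ (fun y => fderiv ℝ f y v) x w) =
      fun x => fderiv ℝ (fun y => fderiv ℝ f y w) x v := by
  funext x
  have hd : DifferentiableAt ℝ (fderiv ℝ f) x :=
    ((hf.fderiv_right (m := ∞) le_rfl).differentiable (by simp)) x
  have hsymm : IsSymmSndFDerivAt ℝ f x := hf.contDiffAt.isSymmSndFDerivAt
    (by simpa using ENat.LEInfty.out)
  simpa [fderiv_clm_apply hd (differentiableAt_const _)] using hsymm w v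

end DirectionalDerivative

theorem contDiff_dq {N : ℕ} (i : Fin N) {f : (Fin N → ℝ) × (Fin N → ℝ) → ℝ}
    (hf : ContDiff ℝ ∞ f) : ContDiff ℝ ∞ (dq N i f) :=
  contDiff_fderiv_apply_const hf _

theorem contDiff_dp {N : ℕ} (i : Fin N) {f : (Fin N → ℝ) × (Fin N → ℝ) → ℝ}
    (hf : ContDiff ℝ ∞ f) : ContDiff ℝ ∞ (dp N i f) :=
  contDiff_fderiv_apply_const hf _

theorem hasCompactSupport_dq {N : ℕ} (i : Fin N) {f : (Fin N → ℝ) × (Fin N → ℝ) → ℝ}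
    (hf : HasCompactSupport f) : HasCompactSupport (dq N i f) :=
  hf.fderiv_apply ℝ _

theorem hasCompactSupport_dp {N : ℕ} (i : Fin N) {f : (Fin N → ℝ) × (Fin N → ℝ) → ℝ}
    (hf : HasCompactSupport f) : HasCompactSupport (dp N i f) :=
  hf.fderiv_apply ℝ _

theorem contDiff_Dpow {N : ℕ} (k : ℕ) {f g : (Fin N → ℝ) × (Fin N → ℝ) → ℝ}
    (hf : ContDiff ℝ ∞ f) (hg : ContDiff ℝ ∞ g) : ContDiff ℝ ∞ (Dpow N k f g) := by
  induction k generalizing f g with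
  | zero => exact hf.mul hg
  | succ k ih =>
    exact ContDiff.sum fun i _ =>
      (ih (contDiff_dq i hf) (contDiff_dp i hg)).sub (ih (contDiff_dp i hf) (contDiff_dq i hg))

/-- Leibniz rule for the iterated bidifferential operator. -/
theorem fderiv_Dpow_apply {N : ℕ} (k : ℕ) {f g : (Fin N → ℝ) × (Fin N → ℝ) → ℝ}
    (hf : ContDiff ℝ ∞ f) (hg : ContDiff ℝ ∞ g) (v x : (Fin N → ℝ) × (Fin N → ℝ)) :
    fderiv ℝ (Dpow N k f g) x v =
      Dpow N k (fun y => fderiv ℝ f y v) g x + Dpow N k f (fun y => fderiv ℝ g y v) x := by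
  induction k generalizing f g with
  | zero =>
    have := fderiv_fun_mul (hf.differentiable (by simp) x) (hg.differentiable (by simp) x)
    simp only [Dpow, this, add_apply, smul_apply, smul_eq_mul]
    ring
  | succ k ih =>
    have hqp (i : Fin N) := contDiff_Dpow k (contDiff_dq i hf) (contDiff_dp i hg)
    have hpq (i : Fin N) := contDiff_Dpow k (contDiff_dp i hf) (contDiff_dq i hg)
    have hq {u : (Fin N → ℝ) × (Fin N → ℝ) → ℝ} (hu : ContDiff ℝ ∞ u) (i : Fin N) :
        (fun y => fderiv ℝ (dq N i u) y v) = dq N i fun y => fderiv ℝ u y v :=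
      fderiv_fderiv_apply_comm hu _ _
    have hp {u : (Fin N → ℝ) × (Fin N → ℝ) → ℝ} (hu : ContDiff ℝ ∞ u) (i : Fin N) :
        (fun y => fderiv ℝ (dp N i u) y v) = dp N i fun y => fderiv ℝ u y v :=
      fderiv_fderiv_apply_comm hu _ _
    simp only [Dpow]
    rw [fderiv_fun_sum fun i _ =>
        ((hqp i).sub (hpq i)).differentiable (by simp) x, sum_apply,
      ← Finset.sum_add_distrib]
    refine Finset.sum_congr rfl fun i _ => ?_
    rw [fderiv_fun_sub ((hqp i).differentiable (by simp) x) ((hpq i).differentiable (by simp) x),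
      sub_apply, ih (contDiff_dq i hf) (contDiff_dp i hg),
      ih (contDiff_dp i hf) (contDiff_dq i hg), hq hf, hp hf, hq hg, hp hg]
    ring

theorem integral_mul_fderiv_apply_eq_neg {N : ℕ} {u g : (Fin N → ℝ) × (Fin N → ℝ) → ℝ}
    (hu : ContDiff ℝ ∞ u) (hg : ContDiff ℝ ∞ g) (hgc : HasCompactSupport g)
    (v : (Fin N → ℝ) × (Fin N → ℝ)) :
    ∫ x, u x * fderiv ℝ g x v = -∫ x, fderiv ℝ u x v * g x := by
  have hu' := contDiff_fderiv_apply_const hu v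
  have hg' := contDiff_fderiv_apply_const hg v
  have : (volume : Measure ((Fin N → ℝ) × (Fin N → ℝ))).IsAddHaarMeasure :=
    Measure.prod.instIsAddHaarMeasure _ _
  refine integral_mul_fderiv_eq_neg_fderiv_mul_of_integrable ?_ ?_ ?_
    (fun x _ => hu.differentiable (by simp) x) (fun x _ => hg.differentiable (by simp) x)
  · exact (hu'.mul hg).continuous.integrable_of_hasCompactSupport hgc.mul_left
  · exact (hu.mul hg').continuous.integrable_of_hasCompactSupport (hgc.fderiv_apply ℝ v).mul_left
  · exact (hu.mul hg).continuous.integrable_of_hasCompactSupport hgc.mul_left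

theorem integral_mul_Dpow {N : ℕ} (k : ℕ) {f g h : (Fin N → ℝ) × (Fin N → ℝ) → ℝ}
    (hf : ContDiff ℝ ∞ f) (hg : ContDiff ℝ ∞ g) (hh : ContDiff ℝ ∞ h)
    (hfc : HasCompactSupport f) (hgc : HasCompactSupport g) :
    ∫ x, f x * Dpow N k h g x = (-1) ^ k * ∫ x, Dpow N k h f x * g x := by
  induction k generalizing g h with
  | zero => simp only [Dpow, pow_zero, one_mul]; congr 1; ext x; ring
  | succ k ih =>
    have hleft {u w : (Fin N → ℝ) × (Fin N → ℝ) → ℝ} (hu : ContDiff ℝ ∞ u)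
        (hw : ContDiff ℝ ∞ w) : Integrable fun x => f x * Dpow N k u w x :=
      (hf.mul (contDiff_Dpow k hu hw)).continuous.integrable_of_hasCompactSupport hfc.mul_right
    have hright {u w : (Fin N → ℝ) × (Fin N → ℝ) → ℝ} (hu : ContDiff ℝ ∞ u)
        (hw : ContDiff ℝ ∞ w) : Integrable fun x => Dpow N k u w x * g x :=
      ((contDiff_Dpow k hu hw).mul hg).continuous.integrable_of_hasCompactSupport hgc.mul_left
    have hp (i : Fin N) := contDiff_dp i hh
    have hq (i : Fin N) := contDiff_dq i hh
    have hfp (i : Fin N) := contDiff_dp i hf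
    have hfq (i : Fin N) := contDiff_dq i hf
    have hgp (i : Fin N) := contDiff_dp i hg
    have hgq (i : Fin N) := contDiff_dq i hg
    have hparts_p (i : Fin N) :
        ∫ x, Dpow N k (dq N i h) f x * dp N i g x =
          -(∫ x, Dpow N k (dp N i (dq N i h)) f x * g x) -
            ∫ x, Dpow N k (dq N i h) (dp N i f) x * g x := by
      rw [← neg_add', ← integral_add (hright (contDiff_dp i (hq i)) hf) (hright (hq i) (hfp i))]
      refine (integral_mul_fderiv_apply_eq_neg (contDiff_Dpow k (hq i) hf) hg hgc _).trans ?_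
      simp only [fderiv_Dpow_apply k (hq i) hf, add_mul]
      rfl
    have hparts_q (i : Fin N) :
        ∫ x, Dpow N k (dp N i h) f x * dq N i g x =
          -(∫ x, Dpow N k (dp N i (dq N i h)) f x * g x) -
            ∫ x, Dpow N k (dp N i h) (dq N i f) x * g x := by
      have hcomm : dp N i (dq N i h) = dq N i (dp N i h) := fderiv_fderiv_apply_comm hh _ _
      rw [hcomm, ← neg_add',
        ← integral_add (hright (contDiff_dq i (hp i)) hf) (hright (hp i) (hfq i))]
      refine (integral_mul_fderiv_apply_eq_neg (contDiff_Dpow k (hp i) hf) hg hgc _).trans ?_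
      simp only [fderiv_Dpow_apply k (hp i) hf, add_mul]
      rfl
    simp only [Dpow, Finset.mul_sum, Finset.sum_mul, mul_sub, sub_mul]
    have hint_left (i : Fin N) := (hleft (hq i) (hgp i)).sub (hleft (hp i) (hgq i))
    have hint_right (i : Fin N) := (hright (hq i) (hfp i)).sub (hright (hp i) (hfq i))
    simp only [Pi.sub_def] at hint_left hint_right
    rw [integral_finsetSum _ fun i _ => hint_left i,
      integral_finsetSum _ fun i _ => hint_right i, Finset.mul_sum]
    refine Finset.sum_congr rfl fun i _ => ?_
    rw [integral_sub (hleft (hq i) (hgp i)) (hleft (hp i) (hgq i)),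
      integral_sub (hright (hq i) (hfp i)) (hright (hp i) (hfq i)),
      ih (hgp i) (hq i) (hasCompactSupport_dp i hgc),
      ih (hgq i) (hp i) (hasCompactSupport_dq i hgc), hparts_p, hparts_q]
    ring

/-- The map `g ↦ ⟦h,g⟧` is skew-adjoint for the L² pairing: for smooth compactly
supported `f, g, h` on phase space, `∫ f·⟦h,g⟧ = −∫ ⟦h,f⟧·g`. -/
theorem statement4 (N : ℕ) (hbar : ℝ) (hhbar : 0 < hbar) (a : ℕ → ℝ) (N₀ : ℕ)
    (ha0 : a 0 = 1) (haN : ∀ n, N₀ < n → a n = 0)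
    (f g h : (Fin N → ℝ) × (Fin N → ℝ) → ℝ)
    (hf : ContDiff ℝ (⊤ : ℕ∞) f) (hg : ContDiff ℝ (⊤ : ℕ∞) g) (hh : ContDiff ℝ (⊤ : ℕ∞) h)
    (hfc : HasCompactSupport f) (hgc : HasCompactSupport g) (hhc : HasCompactSupport h) :
    ∫ x, f x * gmb N a hbar N₀ h g x = -∫ x, gmb N a hbar N₀ h f x * g x := by
  have hleft (k : ℕ) : Integrable fun x => f x * Dpow N k h g x :=
    (hf.mul (contDiff_Dpow k hh hg)).continuous.integrable_of_hasCompactSupport hfc.mul_right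
  have hright (k : ℕ) : Integrable fun x => Dpow N k h f x * g x :=
    ((contDiff_Dpow k hh hf).mul hg).continuous.integrable_of_hasCompactSupport hgc.mul_left
  simp only [gmb, Finset.mul_sum, Finset.sum_mul, mul_left_comm (f _), mul_assoc (_ * _ : ℝ)]
  rw [integral_finsetSum _ fun n _ => (hleft _).const_mul _,
    integral_finsetSum _ fun n _ => (hright _).const_mul _, ← Finset.sum_neg_distrib]
  refine Finset.sum_congr rfl fun n _ => ?_
  rw [integral_const_mul, integral_const_mul, integral_mul_Dpow _ hf hg hh hfc hgc,
    Odd.neg_one_pow ⟨n, rfl⟩]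
  ring
end

section
/- Suppose a generalized bracket ⟦f,g⟧' = ∑_k b_k ħ^{k−1} (f D_ω^k g) on phase space ℝ × ℝ includes an even power of D_ω: let n ≥ 1 be the smallest natural number such that b_{2n} ≠ 0 and assume b_{2m} = 0 for all 0 ≤ m < n. Then for f(q,p) = (qp)^n one has ⟦f,f⟧' = b_{2n} ħ^{2n−1} (−1)^n (2n)! (n!)², which is nonzero; in particular there exists a function f with ⟦f,f⟧' ≠ 0. -/
/-- Partial derivative in the position variable `q` on phase space `ℝ × ℝ`. -/
noncomputable def dq1 (f : ℝ × ℝ → ℝ) : ℝ × ℝ → ℝ :=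
  fun x => fderiv ℝ f x (1, 0)

/-- Partial derivative in the momentum variable `p` on phase space `ℝ × ℝ`. -/
noncomputable def dp1 (f : ℝ × ℝ → ℝ) : ℝ × ℝ → ℝ :=
  fun x => fderiv ℝ f x (0, 1)

/-- Iterated bidifferential operator on `ℝ × ℝ`: `Dpow1 k f g = f D_ω^k g`, with
`f D_ω^0 g = f·g` and
`f D_ω^{k+1} g = (∂f/∂q) D_ω^k (∂g/∂p) − (∂f/∂p) D_ω^k (∂g/∂q)`. -/
noncomputable def Dpow1 : ℕ → (ℝ × ℝ → ℝ) → (ℝ × ℝ → ℝ) → ℝ × ℝ → ℝ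
  | 0, f, g => fun x => f x * g x
  | k + 1, f, g => fun x => Dpow1 k (dq1 f) (dp1 g) x - Dpow1 k (dp1 f) (dq1 g) x
/-- A generalized bracket with arbitrary (possibly even) powers of `D_ω`:
`⟦f,g⟧' = ∑_{k=0}^{K₀} b_k ħ^{k−1} (f D_ω^k g)`, where `hbar` plays the role of `ħ`. -/
noncomputable def gbr (b : ℕ → ℝ) (hbar : ℝ) (K₀ : ℕ) (f g : ℝ × ℝ → ℝ) : ℝ × ℝ → ℝ :=
  fun x => ∑ k ∈ Finset.range (K₀ + 1), b k * hbar ^ ((k : ℤ) - 1) * Dpow1 k f g x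

/-- The powers of `D_ω` are graded symmetric. -/
theorem Dpow1_swap (k : ℕ) (f g : ℝ × ℝ → ℝ) (x : ℝ × ℝ) :
    Dpow1 k g f x = (-1) ^ k * Dpow1 k f g x := by
  induction k generalizing f g with
  | zero => simp [Dpow1, mul_comm]
  | succ k ih =>
    simp only [Dpow1]
    rw [ih (dp1 f) (dq1 g), ih (dq1 f) (dp1 g)]
    ring

theorem Dpow1_self_of_odd {k : ℕ} (hk : Odd k) (f : ℝ × ℝ → ℝ) (x : ℝ × ℝ) :
    Dpow1 k f f x = 0 := by
  have h := Dpow1_swap k f f x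
  rw [hk.neg_one_pow] at h
  linarith

/-- The monomial `c q^a p^b` on phase space. -/
def phaseMonomial (c : ℝ) (a b : ℕ) : ℝ × ℝ → ℝ := fun x => c * (x.1 ^ a * x.2 ^ b)

theorem hasFDerivAt_phaseMonomial (c : ℝ) (a b : ℕ) (x : ℝ × ℝ) :
    HasFDerivAt (phaseMonomial c a b)
      (c • (x.1 ^ a • ((b * x.2 ^ (b - 1)) • ContinuousLinearMap.snd ℝ ℝ ℝ) +
        x.2 ^ b • ((a * x.1 ^ (a - 1)) • ContinuousLinearMap.fst ℝ ℝ ℝ))) x := by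
  have h₁ := (hasDerivAt_pow a x.1).comp_hasFDerivAt x (hasFDerivAt_fst (𝕜 := ℝ) (p := x))
  have h₂ := (hasDerivAt_pow b x.2).comp_hasFDerivAt x (hasFDerivAt_snd (𝕜 := ℝ) (p := x))
  exact (h₁.mul h₂).const_mul c

theorem dq1_phaseMonomial (c : ℝ) (a b : ℕ) :
    dq1 (phaseMonomial c a b) = phaseMonomial (c * a) (a - 1) b := by
  funext x
  simp only [dq1, (hasFDerivAt_phaseMonomial c a b x).fderiv, phaseMonomial]
  simp
  ring

theorem dp1_phaseMonomial (c : ℝ) (a b : ℕ) :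
    dp1 (phaseMonomial c a b) = phaseMonomial (c * b) a (b - 1) := by
  funext x
  simp only [dp1, (hasFDerivAt_phaseMonomial c a b x).fderiv, phaseMonomial]
  simp
  ring

theorem cast_mul_descFactorial_pred (a i : ℕ) :
    (a : ℝ) * ((a - 1).descFactorial i : ℝ) = (a.descFactorial (i + 1) : ℝ) := by
  cases a with
  | zero => simp
  | succ a => rw [Nat.succ_descFactorial_succ]; simp

/-- Binomial expansion of the powers of `D_ω` on a pair of monomials. -/
theorem Dpow1_phaseMonomial (k : ℕ) (c d : ℝ) (a b e g : ℕ) (x : ℝ × ℝ) :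
    Dpow1 k (phaseMonomial c a b) (phaseMonomial d e g) x =
      ∑ ij ∈ Finset.HasAntidiagonal.antidiagonal k, (k.choose ij.1 : ℝ) * ((-1) ^ ij.2 *
        phaseMonomial (c * (a.descFactorial ij.1 * b.descFactorial ij.2))
          (a - ij.1) (b - ij.2) x *
        phaseMonomial (d * (e.descFactorial ij.2 * g.descFactorial ij.1))
          (e - ij.2) (g - ij.1) x) := by
  induction k generalizing c d a b e g with
  | zero => simp [Dpow1]
  | succ k ih =>
    rw [Finset.sum_antidiagonal_choose_succ_mul (fun i j => (-1) ^ j *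
        phaseMonomial (c * (a.descFactorial i * b.descFactorial j)) (a - i) (b - j) x *
        phaseMonomial (d * (e.descFactorial j * g.descFactorial i)) (e - j) (g - i) x)]
    simp only [Dpow1, dq1_phaseMonomial, dp1_phaseMonomial, ih]
    rw [sub_eq_neg_add, ← Finset.sum_neg_distrib]
    congr 1
    · refine Finset.sum_congr rfl fun ij _ => ?_
      simp only [phaseMonomial, ← cast_mul_descFactorial_pred, Nat.sub_sub, Nat.add_comm 1]
      ring
    · refine Finset.sum_congr rfl fun ij hij => ?_
      rw [← Nat.choose_symm_of_eq_add (Finset.HasAntidiagonal.mem_antidiagonal.mp hij).symm]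
      simp only [phaseMonomial, ← cast_mul_descFactorial_pred, Nat.sub_sub, Nat.add_comm 1]
      ring

theorem Dpow1_phaseMonomial_self_of_lt {n k : ℕ} (hk : 2 * n < k) (x : ℝ × ℝ) :
    Dpow1 k (phaseMonomial 1 n n) (phaseMonomial 1 n n) x = 0 := by
  rw [Dpow1_phaseMonomial]
  refine Finset.sum_eq_zero fun ij hij => ?_
  rw [Finset.HasAntidiagonal.mem_antidiagonal] at hij
  rcases (by omega : n < ij.1 ∨ n < ij.2) with h | h <;>
    simp [phaseMonomial, Nat.descFactorial_of_lt h]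

theorem Dpow1_two_mul_phaseMonomial_self (n : ℕ) (x : ℝ × ℝ) :
    Dpow1 (2 * n) (phaseMonomial 1 n n) (phaseMonomial 1 n n) x =
      (-1) ^ n * ((2 * n).factorial : ℝ) * (n.factorial : ℝ) ^ 2 := by
  rw [Dpow1_phaseMonomial, Finset.sum_eq_single (n, n)]
  · have h := Nat.choose_mul_factorial_mul_factorial (show n ≤ 2 * n by omega)
    rw [show 2 * n - n = n by omega] at h
    simp only [phaseMonomial, Nat.descFactorial_self, ← h]
    push_cast
    simp
    ring
  · rintro ⟨i, j⟩ hij hne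
    rw [Finset.HasAntidiagonal.mem_antidiagonal] at hij
    have hij' : i ≠ n ∨ j ≠ n := by
      by_contra! h
      exact hne (by simp [h.1, h.2])
    rcases (by grind : n < i ∨ n < j) with h | h <;>
      simp [phaseMonomial, Nat.descFactorial_of_lt h]
  · intro h
    exact absurd (Finset.HasAntidiagonal.mem_antidiagonal.mpr (two_mul n).symm) h

/-- If the bracket `⟦·,·⟧'` includes an even power of `D_ω`, i.e. `n ≥ 1` is the smallest
natural number with `b_{2n} ≠ 0`, then for `f(q,p) = (qp)^n` one has
`⟦f,f⟧' = b_{2n} ħ^{2n−1} (−1)^n (2n)! (n!)² ≠ 0`; in particular some `f` has `⟦f,f⟧' ≠ 0`. -/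
theorem statement7 (hbar : ℝ) (hhbar : 0 < hbar) (b : ℕ → ℝ) (K₀ : ℕ)
    (hbK : ∀ k, K₀ < k → b k = 0)
    (n : ℕ) (hn : 1 ≤ n) (hbn : b (2 * n) ≠ 0) (hmin : ∀ m, m < n → b (2 * m) = 0) :
    gbr b hbar K₀ (fun x => (x.1 * x.2) ^ n) (fun x => (x.1 * x.2) ^ n)
        = (fun _ => b (2 * n) * hbar ^ ((2 * n : ℤ) - 1) *
            ((-1 : ℝ) ^ n * (Nat.factorial (2 * n) : ℝ) * ((Nat.factorial n : ℝ)) ^ 2)) ∧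
      gbr b hbar K₀ (fun x => (x.1 * x.2) ^ n) (fun x => (x.1 * x.2) ^ n) ≠ (fun _ => 0) ∧
      ∃ f : ℝ × ℝ → ℝ, gbr b hbar K₀ f f ≠ fun _ => 0 := by
  have hf : (fun x : ℝ × ℝ => (x.1 * x.2) ^ n) = phaseMonomial 1 n n := by
    funext x
    simp [phaseMonomial, mul_pow]
  have hval : gbr b hbar K₀ (fun x => (x.1 * x.2) ^ n) (fun x => (x.1 * x.2) ^ n)
      = (fun _ => b (2 * n) * hbar ^ ((2 * n : ℤ) - 1) *
          ((-1 : ℝ) ^ n * (Nat.factorial (2 * n) : ℝ) * ((Nat.factorial n : ℝ)) ^ 2)) := by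
    funext x
    simp only [hf, gbr]
    rw [Finset.sum_eq_single (2 * n), Dpow1_two_mul_phaseMonomial_self]
    · push_cast
      rfl
    · intro k _ hk
      rcases Nat.even_or_odd' k with ⟨m, rfl | rfl⟩
      · rcases (by omega : m < n ∨ n < m) with h | h
        · simp [hmin m h]
        · rw [Dpow1_phaseMonomial_self_of_lt (by omega), mul_zero]
      · rw [Dpow1_self_of_odd (odd_two_mul_add_one m), mul_zero]
    · intro h
      rw [hbK _ (by simpa using h)]
      simp
  have hne : gbr b hbar K₀ (fun x => (x.1 * x.2) ^ n) (fun x => (x.1 * x.2) ^ n)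
      ≠ (fun _ => 0) := by
    intro h
    rw [hval] at h
    have h0 := congrFun h (0, 0)
    revert h0
    have := hhbar.ne'
    have := Nat.factorial_ne_zero (2 * n)
    have := Nat.factorial_ne_zero n
    simp only [imp_false]
    positivity
  exact ⟨hval, hne, _, hne⟩
end
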